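/- arXiv:2103.11654 — 4 statements merged into one kernel-verified Lean document; each statement's English description precedes it below -/
import Mathlib

section
/- Let Z = {(x_n)_{n∈ℤ} ∈ S^ℤ : for every n ∈ ℤ, ρ(x_{n−1},x_n) ≥ 1/2 or ρ(x_n,x_{n+1}) ≥ 1/2}. Then Z is a closed, shift-invariant subset of S^ℤ (with the product topology), the shift σ restricted to Z has no fixed point, and for every prime number p the set of p-periodic points P_p(Z,σ) = {x ∈ Z : σ^p x = x} is nonempty. -/
/-- `S = ℝ/2ℤ`, with its quotient (translation-invariant) metric
`ρ(x,y) = min_{n ∈ ℤ} |x - y - 2n|`, which is the distance of the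
normed group structure on `AddCircle (2 : ℝ)`. -/
abbrev S : Type := AddCircle (2 : ℝ)

/-- The left shift on bi-infinite sequences. -/
def shift {α : Type*} (x : ℤ → α) : ℤ → α := fun n => x (n + 1)

/-- The subshift `Z ⊆ S^ℤ`. -/
def Zset : Set (ℤ → S) :=
  {x | ∀ n : ℤ, (1 : ℝ) / 2 ≤ dist (x (n - 1)) (x n) ∨ (1 : ℝ) / 2 ≤ dist (x n) (x (n + 1))}

theorem shift_iterate_apply {α : Type*} (x : ℤ → α) (k : ℕ) (n : ℤ) :
    shift^[k] x n = x (n + k) := by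
  induction k generalizing n with
  | zero => simp
  | succ k ih =>
    rw [Function.iterate_succ_apply', shift, ih]
    push_cast
    ring_nf

theorem dist_zero_one_addCircle_two : dist (0 : S) ((1 : ℝ) : S) = 1 := by
  rw [dist_comm, dist_zero_right, AddCircle.norm_coe_eq_abs_iff 2 two_ne_zero |>.mpr] <;> norm_num

theorem isClosed_Zset : IsClosed Zset := by
  simp only [Zset, Set.ofPred_forall, Set.ofPred_or]
  refine isClosed_iInter fun n => (isClosed_le ?_ ?_).union (isClosed_le ?_ ?_) <;> fun_prop

theorem shift_mem_Zset_iff {x : ℤ → S} : shift x ∈ Zset ↔ x ∈ Zset := by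
  constructor
  · intro h n
    simpa [shift] using h (n - 1)
  · intro h n
    simpa [shift] using h (n + 1)

theorem shift_surjective {α : Type*} : Function.Surjective (shift (α := α)) := fun x =>
  ⟨fun n => x (n - 1), by funext n; simp [shift]⟩

theorem shift_image_Zset : shift '' Zset = Zset := by
  have h : shift ⁻¹' Zset = Zset := Set.ext fun _ => shift_mem_Zset_iff
  conv_lhs => rw [← h]
  exact Set.image_preimage_eq _ shift_surjective

theorem shift_ne_self_of_mem_Zset {x : ℤ → S} (hx : x ∈ Zset) : shift x ≠ x := by
  intro h
  have hstep (n : ℤ) : x (n + 1) = x n := congrFun h n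
  have hprev : x (-1) = x 0 := by simpa using (hstep (-1)).symm
  have hnext : x 1 = x 0 := by simpa using hstep 0
  have := hx 0
  norm_num [hprev, hnext] at this

/-- The `p`-periodic sequence alternating between `0` and `1` on each block of length `p`. -/
noncomputable def alternatingBlocks (p : ℕ) (n : ℤ) : S :=
  if Even (n % p) then 0 else ((1 : ℝ) : S)

theorem dist_alternatingBlocks_succ {p : ℕ} {n : ℤ} (h : (n + 1) % p = n % p + 1) :
    dist (alternatingBlocks p n) (alternatingBlocks p (n + 1)) = 1 := by
  simp only [alternatingBlocks, h, Int.even_add_one]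
  by_cases he : Even (n % p)
  · simpa [he] using dist_zero_one_addCircle_two
  · simpa [he, dist_comm] using dist_zero_one_addCircle_two

theorem alternatingBlocks_mem_Zset {p : ℕ} (hp : 2 ≤ p) : alternatingBlocks p ∈ Zset := by
  have hp' : (2 : ℤ) ≤ p := by exact_mod_cast hp
  intro n
  have h0 := Int.emod_nonneg n (b := p) (by omega)
  have h1 := Int.emod_lt_of_pos n (b := p) (by omega)
  by_cases hn : n % p = 0
  · right
    rw [dist_alternatingBlocks_succ]
    · norm_num
    · rw [Int.add_emod, hn, Int.emod_eq_of_lt (a := 1), zero_add, Int.emod_eq_of_lt] <;> omega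
  · left
    have h : n % p = (n - 1) % p + 1 := by
      have : (n - 1) % p = n % p - 1 := by
        rw [← Int.emod_sub_emod, Int.emod_eq_of_lt] <;> omega
      omega
    have := dist_alternatingBlocks_succ (p := p) (n := n - 1) (by rwa [sub_add_cancel])
    rw [sub_add_cancel] at this
    rw [this]
    norm_num

theorem shift_iterate_alternatingBlocks (p : ℕ) :
    shift^[p] (alternatingBlocks p) = alternatingBlocks p := by
  funext n
  simp [shift_iterate_apply, alternatingBlocks]

/-- `Z` is a closed shift-invariant subset of `S^ℤ` (product topology), the shift on `Z`
has no fixed point, and for every prime `p` the set of `p`-periodic points of `Z` is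
nonempty. -/
theorem stmt0 :
    IsClosed Zset ∧
    shift '' Zset = Zset ∧
    (∀ x ∈ Zset, shift x ≠ x) ∧
    (∀ p : ℕ, p.Prime → ∃ x ∈ Zset, shift^[p] x = x) :=
  ⟨isClosed_Zset, shift_image_Zset, fun _ => shift_ne_self_of_mem_Zset, fun p hp =>
    ⟨alternatingBlocks p, alternatingBlocks_mem_Zset hp.two_le,
      shift_iterate_alternatingBlocks p⟩⟩
end

section
/- Let m ≥ 1 be an integer and p a prime number with p > m!. Identify the set P_p(Σ_m, σ) of p-periodic points of Σ_m := {(x_n)_{n∈ℤ} ∈ (ℤ/3ℤ)^ℤ : x_n ≠ x_{n+m!} for all n} with {x : ℤ/pℤ → ℤ/3ℤ : x_i ≠ x_{i+m!} for all i ∈ ℤ/pℤ}. Then the map sending x to y defined by y_k = x_{k·m!} (multiplication taken in ℤ/pℤ) is a bijection from this set onto {y : ℤ/pℤ → ℤ/3ℤ : y_k ≠ y_{k+1} for all k ∈ ℤ/pℤ}. -/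
/-- Identifying the `p`-periodic points of `Σ_m` with functions `ℤ/pℤ → ℤ/3ℤ`, the map
`x ↦ (k ↦ x_{k·m!})` (multiplication in `ℤ/pℤ`) is a bijection from
`{x : ℤ/pℤ → ℤ/3ℤ : x_i ≠ x_{i+m!} for all i}` onto
`{y : ℤ/pℤ → ℤ/3ℤ : y_k ≠ y_{k+1} for all k}`. -/
theorem stmt10 (m p : ℕ) (hm : 1 ≤ m) (hp : p.Prime) (hmp : m.factorial < p) :
    Set.BijOn (fun (x : ZMod p → ZMod 3) => fun k : ZMod p => x (k * (m.factorial : ZMod p)))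
      {x : ZMod p → ZMod 3 | ∀ i : ZMod p, x i ≠ x (i + (m.factorial : ZMod p))}
      {y : ZMod p → ZMod 3 | ∀ k : ZMod p, y k ≠ y (k + 1)} := by
  have : Fact p.Prime := ⟨hp⟩
  have ha : (m.factorial : ZMod p) ≠ 0 := by
    rw [Ne, ZMod.natCast_eq_zero_iff]
    exact Nat.not_dvd_of_pos_of_lt m.factorial_pos hmp
  refine ⟨fun x hx k => ?_, fun x _ x' _ h => ?_, fun y hy => ?_⟩
  · simpa only [add_mul, one_mul] using hx (k * (m.factorial : ZMod p))
  · funext i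
    simpa only [div_mul_cancel₀ i ha] using congrFun h (i / (m.factorial : ZMod p))
  · refine ⟨fun i => y (i / (m.factorial : ZMod p)), fun i => ?_, ?_⟩
    · simpa only [add_div, div_self ha] using hy (i / (m.factorial : ZMod p))
    · funext k
      simp only [mul_div_cancel_right₀ k ha]
end

section
/- Let (X,T) be a dynamical system (X a compact metrizable space, T : X → X a homeomorphism) having the marker property. Then there is an equivariant continuous map f : X → Y, i.e. a continuous map with f ∘ T = σ ∘ f, where Y := {(x_n)_{n∈ℤ} ∈ S^ℤ : for every n ∈ ℤ, ρ(x_{n−1}, x_n) = 1 or ρ(x_n, x_{n+1}) = 1} and σ is the left shift. -/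
/-- `Y := {(x_n) ∈ S^ℤ : for every n, ρ(x_{n-1},x_n) = 1 or ρ(x_n,x_{n+1}) = 1}`. -/
def Yset : Set (ℤ → S) :=
  {x | ∀ n : ℤ, dist (x (n - 1)) (x n) = 1 ∨ dist (x n) (x (n + 1)) = 1}

/-- A homeomorphism `T` of `X` has the marker property if for each positive integer `N`
there is an open set `U ⊆ X` with `U ∩ T^{-n}U = ∅` for all `0 < n < N` and
`X = ⋃_{n ∈ ℤ} T^n U`. -/
def MarkerProperty {X : Type*} [TopologicalSpace X] (T : X ≃ₜ X) : Prop :=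
  ∀ N : ℕ, 0 < N → ∃ U : Set X, IsOpen U ∧
    (∀ n : ℕ, 0 < n → n < N → U ∩ (⇑T)^[n] ⁻¹' U = ∅) ∧
    (⋃ n : ℤ, ⇑(T.toEquiv ^ n) '' U) = Set.univ

section MarkerPropertyToYset

variable {X : Type*}

theorem dist_coe_eq_one_of_sub_eq_one {a b : ℝ} (hab : b = 1 + a) :
    dist (a : S) (b : S) = 1 := by
  have h1 := AddCircle.norm_half_period_eq (2 : ℝ)
  have h2 : ((b : S) - (a : S)) = ((2 / 2 : ℝ) : S) := by
    rw [← AddCircle.coe_sub, hab]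
    norm_num
  rw [dist_comm, dist_eq_norm, h2, h1]
  norm_num

theorem continuous_toEquiv_zpow [TopologicalSpace X] (T : X ≃ₜ X) (n : ℤ) :
    Continuous ⇑(T.toEquiv ^ n) := by
  induction n with
  | zero => exact continuous_id
  | succ n ih =>
    rw [zpow_add_one, Equiv.Perm.coe_mul]
    exact ih.comp T.continuous
  | pred n ih =>
    rw [zpow_sub_one, Equiv.Perm.coe_mul]
    exact ih.comp T.symm.continuous

theorem exists_continuous_pos_iff_mem [TopologicalSpace X] [TopologicalSpace.MetrizableSpace X]
    {U : Set X} (hU : IsOpen U) :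
    ∃ v : X → ℝ, Continuous v ∧ (∀ x, 0 ≤ v x) ∧ ∀ x, 0 < v x ↔ x ∈ U := by
  let := TopologicalSpace.metrizableSpaceMetric X
  rcases Set.eq_empty_or_nonempty Uᶜ with he | hne
  · refine ⟨fun _ => 1, continuous_const, fun _ => zero_le_one, fun x => ?_⟩
    simp [Set.compl_empty_iff.mp he]
  · refine ⟨fun x => Metric.infDist x Uᶜ, Metric.continuous_infDist_pt _,
      fun _ => Metric.infDist_nonneg, fun x => ?_⟩
    rw [← hU.isClosed_compl.notMem_iff_infDist_pos hne, Set.notMem_compl_iff]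

/-- A compact space covered by the translates of an open set `U` is already covered by finitely
many forward translates of it. -/
theorem exists_forall_exists_lt_zpow_neg_mem [TopologicalSpace X] [CompactSpace X] (T : X ≃ₜ X)
    {U : Set X} (hU : IsOpen U) (hcov : (⋃ n : ℤ, ⇑(T.toEquiv ^ n) '' U) = Set.univ) :
    ∃ L : ℕ, ∀ x, ∃ k < L, (T.toEquiv ^ (-(k : ℤ))) x ∈ U := by
  have hopen : ∀ n : ℤ, IsOpen (⇑(T.toEquiv ^ n) ⁻¹' U) :=
    fun n => hU.preimage (continuous_toEquiv_zpow T n)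
  have hcov' : Set.univ ⊆ ⋃ n : ℤ, ⇑(T.toEquiv ^ n) ⁻¹' U := by
    intro x _
    have hx : x ∈ ⋃ n : ℤ, ⇑(T.toEquiv ^ n) '' U := hcov ▸ Set.mem_univ x
    obtain ⟨n, u, hu, rfl⟩ := Set.mem_iUnion.mp hx
    refine Set.mem_iUnion.mpr ⟨-n, ?_⟩
    rw [Set.mem_preimage, ← Equiv.Perm.mul_apply, ← zpow_add, neg_add_cancel]
    exact hu
  obtain ⟨F, hF⟩ := isCompact_univ.elim_finite_subcover _ hopen hcov'
  let M : ℕ := F.sup Int.natAbs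
  refine ⟨2 * M + 1, fun x => ?_⟩
  obtain ⟨n, hn, hx⟩ := Set.mem_iUnion₂.mp (hF (Set.mem_univ ((T.toEquiv ^ (-(M : ℤ))) x)))
  have hM : n.natAbs ≤ M := Finset.le_sup (f := Int.natAbs) hn
  refine ⟨(M - n).toNat, by omega, ?_⟩
  rw [Set.mem_preimage, ← Equiv.Perm.mul_apply, ← zpow_add] at hx
  convert hx using 3
  omega

/-- A continuous function supported in `U` and taking the value `1` along every backward orbit
within bounded time. -/
theorem exists_continuous_marker [TopologicalSpace X] [CompactSpace X]
    [TopologicalSpace.MetrizableSpace X] (T : X ≃ₜ X) {U : Set X} (hU : IsOpen U)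
    (hcov : (⋃ n : ℤ, ⇑(T.toEquiv ^ n) '' U) = Set.univ) :
    ∃ (w : X → ℝ) (L : ℕ), Continuous w ∧ (∀ x, w x ≠ 0 → x ∈ U) ∧
      ∀ x, ∃ k < L, w ((T.toEquiv ^ (-(k : ℤ))) x) = 1 := by
  obtain ⟨v, hv, hv0, hvU⟩ := exists_continuous_pos_iff_mem hU
  obtain ⟨L, hL⟩ := exists_forall_exists_lt_zpow_neg_mem T hU hcov
  have hcont : Continuous fun x => ∑ k ∈ Finset.range L, v ((T.toEquiv ^ (-(k : ℤ))) x) :=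
    continuous_finsetSum _ fun k _ => hv.comp (continuous_toEquiv_zpow T _)
  have hpos : ∀ x, 0 < ∑ k ∈ Finset.range L, v ((T.toEquiv ^ (-(k : ℤ))) x) := by
    intro x
    obtain ⟨k, hk, hkU⟩ := hL x
    exact Finset.sum_pos' (fun _ _ => hv0 _) ⟨k, Finset.mem_range.mpr hk, (hvU _).mpr hkU⟩
  obtain ⟨ε, hε, hεv⟩ := isCompact_univ.exists_forall_le' hcont.continuousOn
    (a := 0) (fun x _ => hpos x)
  refine ⟨fun x => min 1 (v x * (L / ε)), L, by fun_prop, fun x hx => ?_, fun x => ?_⟩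
  · refine (hvU x).mp ((hv0 x).lt_of_ne fun h => hx ?_)
    simp [← h]
  · obtain ⟨k₀, hk₀, -⟩ := hL x
    have hL0 : (0 : ℝ) < L := by exact_mod_cast (Nat.zero_le _).trans_lt hk₀
    obtain ⟨k, hk, hle⟩ := Finset.exists_le_of_sum_le (s := Finset.range L)
      (f := fun _ : ℕ => ε / L) (g := fun k : ℕ => v ((T.toEquiv ^ (-(k : ℤ))) x))
      ⟨k₀, Finset.mem_range.mpr hk₀⟩ (by
        simp only [Finset.sum_const, Finset.card_range, nsmul_eq_mul]
        rw [mul_div_cancel₀ _ hL0.ne']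
        exact hεv x (Set.mem_univ x))
    refine ⟨k, Finset.mem_range.mp hk, min_eq_left ?_⟩
    calc (1 : ℝ) = ε / L * (L / ε) := by field_simp
      _ ≤ _ := by gcongr

/-- The expected time, truncated at `m`, since the last mark on the backward orbit of a point,
where a point `x` is marked with probability `w x`. -/
def truncatedAge (T : Equiv.Perm X) (w : X → ℝ) : ℕ → X → ℝ
  | 0, _ => 0
  | m + 1, x => (1 - w x) * (1 + truncatedAge T w m ((T ^ (-1 : ℤ)) x))

theorem continuous_truncatedAge [TopologicalSpace X] (T : X ≃ₜ X) {w : X → ℝ}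
    (hw : Continuous w) (m : ℕ) : Continuous (truncatedAge T.toEquiv w m) := by
  induction m with
  | zero => exact continuous_const
  | succ m ih =>
    exact (continuous_const.sub hw).mul
      (continuous_const.add (ih.comp (continuous_toEquiv_zpow T _)))

theorem truncatedAge_succ_eq_of_lt (T : Equiv.Perm X) {w : X → ℝ} {k : ℕ} :
    ∀ {m : ℕ} {x : X}, k < m → w ((T ^ (-(k : ℤ))) x) = 1 →
      truncatedAge T w (m + 1) x = truncatedAge T w m x := by
  induction k with
  | zero =>
    intro m x hm hx
    obtain ⟨m, rfl⟩ := Nat.exists_eq_succ_of_ne_zero hm.ne'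
    have hx' : w x = 1 := by simpa using hx
    simp [truncatedAge, hx']
  | succ k ih =>
    intro m x hm hx
    obtain ⟨m, rfl⟩ := Nat.exists_eq_succ_of_ne_zero (Nat.ne_zero_of_lt hm)
    have hx' : w ((T ^ (-(k : ℤ))) ((T ^ (-1 : ℤ)) x)) = 1 := by
      rw [← Equiv.Perm.mul_apply, ← zpow_add, ← hx]
      congr 3
      push_cast
      ring
    have hstep := ih (Nat.lt_of_succ_lt_succ hm) hx'
    rw [truncatedAge, hstep, truncatedAge]

end MarkerPropertyToYset

/-- If a dynamical system `(X,T)` (compact metrizable `X`, homeomorphism `T`) has the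
marker property, then there is an equivariant continuous map from `(X,T)` to `(Y,σ)`. -/
theorem stmt13 {X : Type*} [TopologicalSpace X] [CompactSpace X]
    [TopologicalSpace.MetrizableSpace X] (T : X ≃ₜ X) (h : MarkerProperty T) :
    ∃ f : X → (ℤ → S), Continuous f ∧ (∀ x, f x ∈ Yset) ∧
      ∀ x, f (T x) = shift (f x) := by
  obtain ⟨U, hU, hdisj, hcov⟩ := h 2 two_pos
  obtain ⟨w, L, hw, hwU, hwL⟩ := exists_continuous_marker T hU hcov
  let g : X → ℝ := truncatedAge T.toEquiv w L
  have hg : ∀ x, w x = 0 → g x = 1 + g ((T.toEquiv ^ (-1 : ℤ)) x) := by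
    intro x hx
    obtain ⟨k, hk, hkx⟩ := hwL x
    have hstep := truncatedAge_succ_eq_of_lt T.toEquiv hk hkx
    rw [truncatedAge, hx, sub_zero, one_mul] at hstep
    exact hstep.symm
  have hdist : ∀ (x : X) (n : ℤ), w ((T.toEquiv ^ n) x) = 0 →
      dist (g ((T.toEquiv ^ (n - 1)) x) : S) (g ((T.toEquiv ^ n) x) : S) = 1 := by
    intro x n hx
    apply dist_coe_eq_one_of_sub_eq_one
    rw [hg _ hx, ← Equiv.Perm.mul_apply, ← zpow_add, neg_add_eq_sub]
  refine ⟨fun x n => (g ((T.toEquiv ^ n) x) : S), ?_, fun x n => ?_, fun x => ?_⟩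
  · exact continuous_pi fun n => (AddCircle.continuous_mk' 2).comp
      ((continuous_truncatedAge T hw L).comp (continuous_toEquiv_zpow T n))
  · by_cases hn : w ((T.toEquiv ^ n) x) = 0
    · exact Or.inl (hdist x n hn)
    · right
      have hn1 : w ((T.toEquiv ^ (n + 1)) x) = 0 := by
        by_contra hne
        have hmem : (T.toEquiv ^ n) x ∈ U ∩ (⇑T)^[1] ⁻¹' U := by
          refine ⟨hwU _ hn, ?_⟩
          have hU1 := hwU _ hne
          rw [add_comm, zpow_one_add, Equiv.Perm.mul_apply] at hU1
          exact hU1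
        rw [hdisj 1 one_pos one_lt_two] at hmem
        exact hmem
      simpa using hdist x (n + 1) hn1
  · funext n
    simp only [shift]
    rw [zpow_add_one, Equiv.Perm.mul_apply]
    rfl
end

section
/- Let (X_n, T_n)_{n∈ℕ} be dynamical systems (each X_n compact metrizable, T_n a homeomorphism). For m > n let τ_{m,n} : X_m → X_n be continuous equivariant maps (τ_{m,n} ∘ T_m = T_n ∘ τ_{m,n}) satisfying τ_{m,n} = τ_{k,n} ∘ τ_{m,k} for all m > k > n, and suppose there are continuous maps γ_{n,m} : X_n → X_m (m > n) with τ_{m,n} ∘ γ_{n,m} = id and γ_{n,m} = γ_{k,m} ∘ γ_{n,k} for all m > k > n. Let (X,T) be the inverse limit: X := {(x_n)_{n∈ℕ} ∈ Π_n X_n : τ_{m,n}(x_m) = x_n for all m > n} with T acting coordinatewise. If there exists an equivariant continuous map f : X → Y (f ∘ T = σ ∘ f), then there exist an integer M and an equivariant continuous map g : X_M → Z (g ∘ T_M = σ ∘ g). -/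
/-- The canonical lift of a point of `X M` to the product, along the bonding maps below `M` and
the sections above `M`. -/
def limLift {X : ℕ → Type*} (τ γ : ∀ m n : ℕ, X m → X n) (M : ℕ) (z : X M) (m : ℕ) : X m :=
  if h : m = M then h ▸ z else if m < M then τ M m z else γ M m z

section limLift

variable {X : ℕ → Type*} (τ γ : ∀ m n : ℕ, X m → X n) {M m : ℕ} (z : X M)

@[simp] theorem limLift_self : limLift τ γ M z M = z := by simp [limLift]

theorem limLift_of_lt (h : m < M) : limLift τ γ M z m = τ M m z := by
  simp [limLift, h, h.ne]

theorem limLift_of_gt (h : M < m) : limLift τ γ M z m = γ M m z := by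
  simp [limLift, h.not_gt, h.ne']

theorem continuous_limLift [∀ n, TopologicalSpace (X n)]
    (hτc : ∀ m n : ℕ, n < m → Continuous (τ m n))
    (hγc : ∀ n m : ℕ, n < m → Continuous (γ n m)) : Continuous (limLift τ γ M) := by
  refine continuous_pi fun m => ?_
  rcases lt_trichotomy m M with h | rfl | h
  · simpa only [limLift_of_lt τ γ _ h] using hτc M m h
  · simpa only [limLift_self] using continuous_id'
  · simpa only [limLift_of_gt τ γ _ h] using hγc M m h

theorem limLift_compatible
    (hττ : ∀ m k n : ℕ, n < k → k < m → ∀ x, τ m n x = τ k n (τ m k x))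
    (hτγ : ∀ n m : ℕ, n < m → ∀ x, τ m n (γ n m x) = x)
    (hγγ : ∀ n k m : ℕ, n < k → k < m → ∀ x, γ n m x = γ k m (γ n k x))
    {n : ℕ} (hnm : n < m) : τ m n (limLift τ γ M z m) = limLift τ γ M z n := by
  rcases lt_trichotomy m M with h | rfl | h
  · rw [limLift_of_lt τ γ z h, limLift_of_lt τ γ z (hnm.trans h), hττ M m n hnm h]
  · rw [limLift_self, limLift_of_lt τ γ z hnm]
  · rw [limLift_of_gt τ γ z h]
    rcases lt_trichotomy n M with h' | rfl | h'
    · rw [limLift_of_lt τ γ z h', hττ m M n h' h, hτγ M m h]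
    · rw [limLift_self, hτγ n m h]
    · rw [limLift_of_gt τ γ z h', hγγ M n m h' hnm, hτγ n m hnm]

end limLift

/-- A continuous function on an inverse limit of compact Hausdorff spaces is determined up to
`ε` by a single coordinate. -/
theorem exists_coord_dist_lt {X : ℕ → Type*} [∀ n, TopologicalSpace (X n)]
    [∀ n, CompactSpace (X n)] [∀ n, T2Space (X n)] {E : Type*} [PseudoMetricSpace E]
    (τ : ∀ m n : ℕ, X m → X n) (hτc : ∀ m n : ℕ, n < m → Continuous (τ m n))
    (φ : {x : ∀ n, X n | ∀ m n : ℕ, n < m → τ m n (x m) = x n} → E) (hφ : Continuous φ)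
    {ε : ℝ} (hε : 0 < ε) :
    ∃ M : ℕ, ∀ x y, x.1 M = y.1 M → dist (φ x) (φ y) < ε := by
  let L := {x : ∀ n, X n | ∀ m n : ℕ, n < m → τ m n (x m) = x n}
  have hLc : IsClosed L := by
    simp only [L, Set.ofPred_forall]
    exact isClosed_iInter fun m => isClosed_iInter fun n => isClosed_iInter fun h =>
      isClosed_eq ((hτc m n h).comp (continuous_apply m)) (continuous_apply n)
  have : CompactSpace L := isCompact_iff_compactSpace.mp hLc.isCompact
  by_contra! hcon
  let K : ℕ → Set (L × L) := fun M => {p | p.1.1 M = p.2.1 M ∧ ε ≤ dist (φ p.1) (φ p.2)}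
  have hcoord : ∀ M, Continuous fun x : L => x.1 M := fun M =>
    (continuous_apply M).comp continuous_subtype_val
  have hKc : ∀ M, IsClosed (K M) := fun M =>
    (isClosed_eq ((hcoord M).comp continuous_fst) ((hcoord M).comp continuous_snd)).inter
      (isClosed_le continuous_const
        ((hφ.comp continuous_fst).dist (hφ.comp continuous_snd)))
  obtain ⟨⟨x, y⟩, hxy⟩ := IsCompact.nonempty_iInter_of_sequence_nonempty_isCompact_isClosed K
    (fun M p hp => ⟨by
      rw [← p.1.2 (M + 1) M M.lt_succ_self, ← p.2.2 (M + 1) M M.lt_succ_self, hp.1], hp.2⟩)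
    (fun M => let ⟨x, y, h⟩ := hcon M; ⟨(x, y), h⟩) (hKc 0).isCompact hKc
  rw [Set.mem_iInter] at hxy
  obtain rfl : x = y := Subtype.ext (funext fun M => (hxy M).1)
  have := (hxy 0).2
  rw [dist_self] at this
  exact absurd hε this.not_gt

/-- Let `(X_n, T_n)` be dynamical systems with compatible continuous equivariant bonding
maps `τ_{m,n} : X_m → X_n` (for `m > n`) admitting compatible continuous sections
`γ_{n,m} : X_n → X_m`, and let `(X,T)` be the inverse limit with `T` acting
coordinatewise.  If there is an equivariant continuous map `f : X → Y`, then there exist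
an integer `M` and an equivariant continuous map `g : X_M → Z`. -/
theorem stmt16 {X : ℕ → Type*} [∀ n, TopologicalSpace (X n)] [∀ n, CompactSpace (X n)]
    [∀ n, TopologicalSpace.MetrizableSpace (X n)]
    (T : ∀ n, X n ≃ₜ X n)
    (τ : ∀ m n : ℕ, X m → X n) (γ : ∀ n m : ℕ, X n → X m)
    (hτc : ∀ m n : ℕ, n < m → Continuous (τ m n))
    (hτe : ∀ m n : ℕ, n < m → ∀ x, τ m n (T m x) = T n (τ m n x))
    (hττ : ∀ m k n : ℕ, n < k → k < m → ∀ x, τ m n x = τ k n (τ m k x))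
    (hγc : ∀ n m : ℕ, n < m → Continuous (γ n m))
    (hτγ : ∀ n m : ℕ, n < m → ∀ x, τ m n (γ n m x) = x)
    (hγγ : ∀ n k m : ℕ, n < k → k < m → ∀ x, γ n m x = γ k m (γ n k x))
    (f : (∀ n, X n) → (ℤ → S))
    (hfc : ContinuousOn f {x | ∀ m n : ℕ, n < m → τ m n (x m) = x n})
    (hfY : ∀ x ∈ {x : ∀ n, X n | ∀ m n : ℕ, n < m → τ m n (x m) = x n}, f x ∈ Yset)
    (hfe : ∀ x ∈ {x : ∀ n, X n | ∀ m n : ℕ, n < m → τ m n (x m) = x n},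
      f (fun n => T n (x n)) = shift (f x)) :
    ∃ (M : ℕ) (g : X M → (ℤ → S)), Continuous g ∧ (∀ x, g x ∈ Zset) ∧
      ∀ x, g (T M x) = shift (g x) := by
  set L := {x : ∀ n, X n | ∀ m n : ℕ, n < m → τ m n (x m) = x n}
  have hf0 : Continuous fun x : L => f x.1 0 :=
    (continuous_apply 0).comp (continuousOn_iff_continuous_domRestrict.mp hfc)
  obtain ⟨M, hM⟩ := exists_coord_dist_lt τ hτc (fun x => f x.1 0) hf0 one_half_pos
  have hlift : ∀ z, limLift τ γ M z ∈ L := fun z _ _ h =>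
    limLift_compatible τ γ z hττ hτγ hγγ h
  have hT : ∀ x ∈ L, (fun n => T n (x n)) ∈ L := fun x hx m n h => by
    simp only [hτe m n h, hx m n h]
  have hT' : ∀ x ∈ L, (fun n => (T n).symm (x n)) ∈ L := fun x hx m n h => by
    apply (T n).injective
    simp only [← hτe m n h, Homeomorph.apply_symm_apply, hx m n h]
  refine ⟨M, fun z n => f (limLift τ γ M ((T M ^ n) z)) 0, ?_, fun z n => ?_, fun z => ?_⟩
  · refine continuous_pi fun n => ?_
    have h : Continuous fun z => (⟨_, hlift ((T M ^ n) z)⟩ : L) :=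
      ((continuous_limLift τ γ hτc hγc).comp (T M ^ n).continuous).subtype_mk _
    exact hf0.comp h
  · beta_reduce
    have hnext : (T M ^ (n + 1)) z = T M ((T M ^ n) z) := by
      rw [add_comm, zpow_one_add]; rfl
    have hprev : (T M ^ (n - 1)) z = (T M).symm ((T M ^ n) z) := by
      rw [sub_eq_neg_add, zpow_add, zpow_neg_one]; rfl
    rw [hnext, hprev]
    set w := (T M ^ n) z
    set x := limLift τ γ M w with hx
    have hxL : x ∈ L := hlift w
    have h1 : f x 1 = f (fun n => T n (x n)) 0 := by
      rw [hfe x hxL]; rfl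
    have h2 : f x (-1) = f (fun n => (T n).symm (x n)) 0 := by
      have := hfe _ (hT' x hxL)
      simp only [Homeomorph.apply_symm_apply] at this
      rw [this]; rfl
    have d1 := hM ⟨_, hT x hxL⟩ ⟨_, hlift (T M w)⟩ (by simp [hx])
    have d2 := hM ⟨_, hT' x hxL⟩ ⟨_, hlift ((T M).symm w)⟩ (by simp [hx])
    dsimp only at d1 d2
    rw [← h1] at d1
    rw [← h2] at d2
    refine (hfY x hxL 0).imp (fun h => ?_) fun h => ?_
    · rw [zero_sub] at h
      linarith [dist_triangle (f x (-1)) (f (limLift τ γ M ((T M).symm w)) 0) (f x 0)]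
    · rw [zero_add] at h
      linarith [dist_triangle_right (f x 0) (f x 1) (f (limLift τ γ M (T M w)) 0)]
  · funext n
    simp only [shift, zpow_add_one]
    rfl
end
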